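/- Assume there is a constant c₁ > 0 such that every primitive integer solution (X,Y,Z) of X+Y=Z with XYZ ≠ 0 and R(X,Y,Z) ≥ 3 satisfies H(X,Y,Z) ≤ exp(c₁·R(X,Y,Z)^{1/3}·(log R(X,Y,Z))^3) (the Stewart–Yu bound). Then for each ε with 0 < ε < 3 there are only finitely many primitive integer solutions (X,Y,Z) of X+Y=Z with XYZ ≠ 0 and H(X,Y,Z) ≥ 16 satisfying S(X,Y,Z) ≤ (3−ε)·log log H(X,Y,Z). -/

import Mathlib

noncomputable section

/-- Height of a triple: `max(|X|,|Y|,|Z|)`. -/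
def height (X Y Z : ℤ) : ℤ := max |X| (max |Y| |Z|)

/-- Smoothness of a triple: the largest prime dividing `X*Y*Z`. -/
def smoothness (X Y Z : ℤ) : ℕ := sSup {p : ℕ | p.Prime ∧ (p : ℤ) ∣ X * Y * Z}

/-- Radical of a triple: the product of the primes dividing `X*Y*Z`. -/
def radical (X Y Z : ℤ) : ℕ := ∏ p ∈ (X * Y * Z).natAbs.primeFactors, p

/-- A primitive nondegenerate solution of the abc equation. -/
def IsPrimitiveSolution (X Y Z : ℤ) : Prop :=
  X + Y = Z ∧ X * Y * Z ≠ 0 ∧ Int.gcd X (Int.gcd Y Z) = 1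

open Filter Topology MeasureTheory

/-- The Fejér kernel `(1 - cos v) / v ^ 2`, written as a cosine transform of a tent function. -/
noncomputable def fejerKernel (v : ℝ) : ℝ := ∫ t in (0 : ℝ)..1, (1 - t) * Real.cos (t * v)

theorem fejerKernel_eq {v : ℝ} (hv : v ≠ 0) : fejerKernel v = (1 - Real.cos v) / v ^ 2 := by
  have hderiv : ∀ t ∈ Set.uIcc (0 : ℝ) 1, HasDerivAt
      (fun t => (1 - t) * Real.sin (t * v) / v - Real.cos (t * v) / v ^ 2)
      ((1 - t) * Real.cos (t * v)) t := by
    intro t _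
    have h₁ : HasDerivAt (fun t : ℝ => t * v) v t := hasDerivAt_mul_const v
    have h₂ : HasDerivAt (fun t : ℝ => 1 - t) (-1) t := (hasDerivAt_id t).const_sub 1
    convert! ((h₂.mul h₁.sin).div_const v).sub (h₁.cos.div_const (v ^ 2)) using 1
    field_simp
    ring
  rw [fejerKernel, intervalIntegral.integral_eq_sub_of_hasDerivAt hderiv
    (Continuous.intervalIntegrable (by fun_prop) _ _)]
  simp
  ring

theorem fejerKernel_continuous : Continuous fejerKernel :=
  intervalIntegral.continuous_parametric_intervalIntegral_of_continuous' (by fun_prop) 0 1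

theorem fejerKernel_zero : fejerKernel 0 = 1 / 2 := by
  simp only [fejerKernel, mul_zero, Real.cos_zero, mul_one]
  rw [intervalIntegral.integral_sub (by simp) (by simp)]
  norm_num

theorem fejerKernel_nonneg (v : ℝ) : 0 ≤ fejerKernel v := by
  rcases eq_or_ne v 0 with rfl | hv
  · rw [fejerKernel_zero]; norm_num
  · rw [fejerKernel_eq hv]
    exact div_nonneg (by linarith [Real.cos_le_one v]) (sq_nonneg v)

theorem fejerKernel_le (v : ℝ) : fejerKernel v ≤ 4 * (1 + v ^ 2)⁻¹ := by
  rw [← div_eq_mul_inv, le_div_iff₀ (by positivity)]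
  rcases eq_or_ne v 0 with rfl | hv
  · rw [fejerKernel_zero]; norm_num
  · have h₁ : fejerKernel v * v ^ 2 = 1 - Real.cos v := by
      rw [fejerKernel_eq hv]; field_simp
    have h₂ : fejerKernel v ≤ 1 / 2 := by
      rw [fejerKernel_eq hv, div_le_iff₀ (by positivity)]
      linarith [Real.one_sub_sq_div_two_le_cos (x := v)]
    nlinarith [Real.neg_one_le_cos v]

theorem fejerKernel_integrable : Integrable fejerKernel := by
  refine (integrable_inv_one_add_sq.const_mul 4).mono'
    fejerKernel_continuous.aestronglyMeasurable (ae_of_all _ fun v => ?_)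
  rw [Real.norm_of_nonneg (fejerKernel_nonneg v)]
  exact fejerKernel_le v

theorem integral_fejerKernel_pos : 0 < ∫ v, fejerKernel v :=
  integral_pos_of_integrable_nonneg_nonzero (x := 0) fejerKernel_continuous
    fejerKernel_integrable fejerKernel_nonneg (by rw [fejerKernel_zero]; norm_num)

theorem integrableOn_mul_exp_neg_of_bounded {f : ℝ → ℝ} (hf : Measurable f) {C : ℝ}
    (hC : ∀ u, 0 < u → |f u| ≤ C) {σ : ℝ} (hσ : 0 < σ) :
    IntegrableOn (fun u => f u * Real.exp (-σ * u)) (Set.Ioi 0) := by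
  refine ((integrableOn_exp_mul_Ioi (neg_lt_zero.mpr hσ) 0).const_mul C).mono' (by fun_prop) ?_
  refine (ae_restrict_iff' measurableSet_Ioi).mpr (ae_of_all _ fun u hu => ?_)
  rw [norm_mul, Real.norm_eq_abs, Real.norm_of_nonneg (Real.exp_pos _).le]
  gcongr
  exact hC u hu

theorem re_exp_mul_laplace {f : ℝ → ℝ} (hf : Measurable f) {C : ℝ}
    (hC : ∀ u, 0 < u → |f u| ≤ C) {σ : ℝ} (hσ : 0 < σ) (τ y : ℝ) :
    (Complex.exp (τ * y * Complex.I) *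
      ∫ u in Set.Ioi (0 : ℝ), (f u : ℂ) * Complex.exp (-(σ + τ * Complex.I) * u)).re =
    ∫ u in Set.Ioi (0 : ℝ), f u * Real.exp (-σ * u) * Real.cos (τ * (u - y)) := by
  rw [← integral_const_mul]
  have hre : ∀ u : ℝ, (Complex.exp (τ * y * Complex.I) *
      ((f u : ℂ) * Complex.exp (-(σ + τ * Complex.I) * u))) =
      ((f u * Real.exp (-σ * u) : ℝ) : ℂ) * Complex.exp ((-(τ * (u - y)) : ℝ) * Complex.I) := by
    intro u
    push_cast
    rw [mul_left_comm, mul_assoc (f u : ℂ), ← Complex.exp_add, ← Complex.exp_add]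
    ring_nf
  simp_rw [hre]
  have hint : IntegrableOn (fun u : ℝ => ((f u * Real.exp (-σ * u) : ℝ) : ℂ) *
      Complex.exp ((-(τ * (u - y)) : ℝ) * Complex.I)) (Set.Ioi 0) := by
    refine (integrableOn_mul_exp_neg_of_bounded hf hC hσ).norm.mono' (by fun_prop)
      (ae_of_all _ fun u => ?_)
    rw [norm_mul, Complex.norm_exp_ofReal_mul_I, mul_one, Complex.norm_real]
  change Complex.reCLM _ = _
  rw [← Complex.reCLM.integral_comp_comm hint]
  refine integral_congr_ae (ae_of_all _ fun u => ?_)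
  simp only [Complex.reCLM_apply, Complex.re_ofReal_mul, Complex.exp_ofReal_mul_I_re, Real.cos_neg]

/-- Averaging a Laplace transform over a vertical segment against the tent function amounts to
integrating against the Fejér kernel. -/
theorem integral_tent_mul_laplace {f : ℝ → ℝ} (hf : Measurable f) {C : ℝ}
    (hC : ∀ u, 0 < u → |f u| ≤ C) {σ : ℝ} (hσ : 0 < σ) (ℓ y : ℝ) :
    ∫ t in (0 : ℝ)..1, (1 - t) * (Complex.exp ((ℓ * t : ℝ) * y * Complex.I) *
      ∫ u in Set.Ioi (0 : ℝ), (f u : ℂ) * Complex.exp (-(σ + (ℓ * t : ℝ) * Complex.I) * u)).re =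
    ∫ u in Set.Ioi (0 : ℝ), f u * Real.exp (-σ * u) * fejerKernel (ℓ * (u - y)) := by
  simp_rw [re_exp_mul_laplace hf hC hσ, ← integral_const_mul]
  have hint := integrableOn_mul_exp_neg_of_bounded hf hC hσ
  rw [intervalIntegral.integral_of_le zero_le_one, integral_integral_swap]
  · refine integral_congr_ae (ae_of_all _ fun u => ?_)
    simp only [fejerKernel]
    rw [intervalIntegral.integral_of_le zero_le_one, ← integral_const_mul]
    refine integral_congr_ae (ae_of_all _ fun t => ?_)
    ring_nf
  · have hone : Integrable (fun _ : ℝ => (1 : ℝ)) (volume.restrict (Set.Ioc (0 : ℝ) 1)) :=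
      integrable_const _
    refine (hone.mul_prod hint.norm).mono' (by fun_prop) ?_
    rw [Measure.prod_restrict]
    refine (ae_restrict_iff' (measurableSet_Ioc.prod measurableSet_Ioi)).mpr
      (ae_of_all _ fun p hp => ?_)
    have hp₁ := hp.1
    simp only [Function.uncurry]
    rw [norm_mul, norm_mul, one_mul]
    have h₁ : ‖1 - p.1‖ ≤ 1 := by
      rw [Real.norm_eq_abs, abs_le]
      constructor <;> linarith [hp₁.1, hp₁.2]
    have h₂ : ‖Real.cos (ℓ * p.1 * (p.2 - y))‖ ≤ 1 := Real.abs_cos_le_one _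
    calc _ ≤ 1 * (‖f p.2 * Real.exp (-σ * p.2)‖ * 1) := by gcongr
      _ = _ := by ring

theorem tendsto_integral_tent_mul_exp {h : ℝ → ℂ} (hh : Continuous h) {ℓ : ℝ} (hℓ : 0 < ℓ) :
    Tendsto (fun y : ℝ => ∫ t in (0 : ℝ)..1,
      (1 - t) * (Complex.exp ((ℓ * t : ℝ) * y * Complex.I) * h t).re) atTop (𝓝 0) := by
  let F : ℝ → ℂ := (Set.Ioc (0 : ℝ) 1).indicator fun t => (1 - t : ℝ) * h t
  have hw : Tendsto (fun y : ℝ => -(ℓ / (2 * Real.pi)) * y) atTop (cocompact ℝ) :=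
    (tendsto_id.const_mul_atTop_of_neg (neg_lt_zero.mpr (by positivity))).mono_right
      atBot_le_cocompact
  have hlim := (Complex.continuous_re.tendsto 0).comp
    ((Real.tendsto_integral_exp_smul_cocompact F).comp hw)
  rw [Complex.zero_re] at hlim
  refine hlim.congr fun y => ?_
  have hF : ∀ v : ℝ, Real.fourierChar (-(v * (-(ℓ / (2 * Real.pi)) * y))) • F v =
      (Set.Ioc (0 : ℝ) 1).indicator
        (fun t => (1 - t : ℝ) * (Complex.exp ((ℓ * t : ℝ) * y * Complex.I) * h t)) v := by
    intro v
    by_cases hv : v ∈ Set.Ioc (0 : ℝ) 1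
    · simp only [F, Set.indicator_of_mem hv, Circle.smul_def, Real.fourierChar_apply, smul_eq_mul]
      rw [mul_left_comm]
      congr 3
      have := Real.pi_ne_zero
      push_cast
      field_simp
    · simp [F, Set.indicator_of_notMem hv]
  simp only [Function.comp_apply]
  simp_rw [hF]
  rw [integral_indicator measurableSet_Ioc, intervalIntegral.integral_of_le zero_le_one]
  change Complex.reCLM _ = _
  have hcont : Continuous fun t : ℝ =>
      ((1 - t : ℝ) : ℂ) * (Complex.exp ((ℓ * t : ℝ) * y * Complex.I) * h t) := by fun_prop
  rw [← Complex.reCLM.integral_comp_comm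
    (hcont.integrableOn_Icc.mono_set Set.Ioc_subset_Icc_self)]
  refine integral_congr_ae (ae_of_all _ fun t => ?_)
  simp only [Complex.reCLM_apply, Complex.re_ofReal_mul]

section Tauberian

variable {B : ℝ → ℝ} {C : ℝ} {g : ℝ → ℝ → ℂ}

/-- The regularised form of the Tauberian inequality. -/
theorem tauberian_inequality_of_pos (hB : Measurable B) (hB₀ : ∀ u, 0 ≤ B u)
    (hC : ∀ u, 0 < u → B u ≤ C) (hmono : ∀ u v, 0 < u → u ≤ v → B u * Real.exp (u - v) ≤ B v)
    (hlap : ∀ σ τ : ℝ, 0 < σ → ∫ u in Set.Ioi (0 : ℝ),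
      ((B u - 1 : ℝ) : ℂ) * Complex.exp (-(σ + τ * Complex.I) * u) = g σ τ)
    {a ℓ y σ : ℝ} (ha : 0 < a) (hℓ : 0 < ℓ) (hy : 0 < y) (hσ : 0 < σ) :
    B y * Real.exp (-(2 * a)) * Real.exp (-σ * (y + 2 * a)) *
      ∫ v in (-(ℓ * a))..(ℓ * a), fejerKernel v ≤
    (∫ v, fejerKernel v) + ℓ * ∫ t in (0 : ℝ)..1,
      (1 - t) * (Complex.exp ((ℓ * t : ℝ) * (y + a : ℝ) * Complex.I) * g σ (ℓ * t)).re := by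
  have hC' : ∀ u, 0 < u → |B u - 1| ≤ C + 1 := fun u hu => by
    rw [abs_le]; constructor <;> linarith [hB₀ u, hC u hu]
  have hCB : ∀ u, 0 < u → |B u| ≤ C := fun u hu => by rw [abs_of_nonneg (hB₀ u)]; exact hC u hu
  have key := integral_tent_mul_laplace (hB.sub_const 1) hC' hσ ℓ (y + a)
  simp_rw [hlap σ _ hσ] at key
  rw [key]
  have hK : ∀ u, ‖fejerKernel (ℓ * (u - (y + a)))‖ ≤ 4 := fun u => by
    rw [Real.norm_of_nonneg (fejerKernel_nonneg _)]
    refine (fejerKernel_le _).trans ?_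
    have : (1 + (ℓ * (u - (y + a))) ^ 2)⁻¹ ≤ 1 := inv_le_one_of_one_le₀
      (by nlinarith [sq_nonneg (ℓ * (u - (y + a)))])
    linarith
  have hKm : AEStronglyMeasurable (fun u => fejerKernel (ℓ * (u - (y + a))))
      (volume.restrict (Set.Ioi 0)) :=
    (fejerKernel_continuous.comp (by fun_prop)).aestronglyMeasurable
  have hi₁ : IntegrableOn (fun u => B u * Real.exp (-σ * u) * fejerKernel (ℓ * (u - (y + a))))
      (Set.Ioi 0) :=
    (integrableOn_mul_exp_neg_of_bounded hB hCB hσ).mul_bdd hKm (ae_of_all _ hK)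
  have hi₂ : IntegrableOn (fun u => Real.exp (-σ * u) * fejerKernel (ℓ * (u - (y + a))))
      (Set.Ioi 0) :=
    (integrableOn_exp_mul_Ioi (neg_lt_zero.mpr hσ) 0).mul_bdd hKm (ae_of_all _ hK)
  have hi₃ : Integrable fun u => fejerKernel (ℓ * (u - (y + a))) :=
    (fejerKernel_integrable.comp_mul_left' hℓ.ne').comp_sub_right (y + a)
  have hsplit : ∫ u in Set.Ioi (0 : ℝ),
      (B u - 1) * Real.exp (-σ * u) * fejerKernel (ℓ * (u - (y + a))) =
      (∫ u in Set.Ioi (0 : ℝ), B u * Real.exp (-σ * u) * fejerKernel (ℓ * (u - (y + a)))) -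
      ∫ u in Set.Ioi (0 : ℝ), Real.exp (-σ * u) * fejerKernel (ℓ * (u - (y + a))) := by
    rw [← integral_sub hi₁ hi₂]
    refine integral_congr_ae (ae_of_all _ fun u => ?_)
    simp only
    ring
  have hupper : ∫ u in Set.Ioi (0 : ℝ), Real.exp (-σ * u) * fejerKernel (ℓ * (u - (y + a))) ≤
      ℓ⁻¹ * ∫ v, fejerKernel v := by
    calc _ ≤ ∫ u in Set.Ioi (0 : ℝ), fejerKernel (ℓ * (u - (y + a))) := by
          refine setIntegral_mono_on hi₂ hi₃.integrableOn measurableSet_Ioi fun u hu => ?_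
          refine mul_le_of_le_one_left (fejerKernel_nonneg _) (Real.exp_le_one_iff.mpr ?_)
          have : 0 < u := hu
          nlinarith
      _ ≤ ∫ u, fejerKernel (ℓ * (u - (y + a))) :=
          setIntegral_le_integral hi₃ (ae_of_all _ fun u => fejerKernel_nonneg _)
      _ = _ := by
          rw [integral_sub_right_eq_self (fun u => fejerKernel (ℓ * u)) (y + a),
            Measure.integral_comp_mul_left, abs_of_pos (inv_pos.mpr hℓ), smul_eq_mul]
  have hlower : B y * Real.exp (-(2 * a)) * Real.exp (-σ * (y + 2 * a)) *
      (ℓ⁻¹ * ∫ v in (-(ℓ * a))..(ℓ * a), fejerKernel v) ≤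
      ∫ u in Set.Ioi (0 : ℝ), B u * Real.exp (-σ * u) * fejerKernel (ℓ * (u - (y + a))) := by
    have hcv : ℓ⁻¹ * ∫ v in (-(ℓ * a))..(ℓ * a), fejerKernel v =
        ∫ u in Set.Ioc y (y + 2 * a), fejerKernel (ℓ * (u - (y + a))) := by
      rw [← intervalIntegral.integral_of_le (by linarith),
        intervalIntegral.integral_comp_sub_right (fun u => fejerKernel (ℓ * u)),
        intervalIntegral.integral_comp_mul_left _ hℓ.ne', smul_eq_mul]
      ring_nf
    rw [hcv, ← integral_const_mul]
    have hsub : Set.Ioc y (y + 2 * a) ⊆ Set.Ioi 0 := fun u hu => hy.trans hu.1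
    calc _ ≤ ∫ u in Set.Ioc y (y + 2 * a),
            B u * Real.exp (-σ * u) * fejerKernel (ℓ * (u - (y + a))) := by
          refine setIntegral_mono_on (hi₃.integrableOn.const_mul _) (hi₁.mono_set hsub)
            measurableSet_Ioc fun u hu => ?_
          refine mul_le_mul_of_nonneg_right ?_ (fejerKernel_nonneg _)
          refine mul_le_mul ?_ ?_ (Real.exp_pos _).le (hB₀ u)
          · refine le_trans ?_ (hmono y u hy hu.1.le)
            refine mul_le_mul_of_nonneg_left (Real.exp_le_exp.mpr ?_) (hB₀ y)
            linarith [hu.2]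
          · refine Real.exp_le_exp.mpr ?_
            nlinarith [hu.2]
      _ ≤ _ := by
          refine setIntegral_mono_set hi₁ ?_ hsub.eventuallyLE
          exact ae_of_all _ fun u => mul_nonneg (mul_nonneg (hB₀ u) (Real.exp_pos _).le)
            (fejerKernel_nonneg _)
  rw [hsplit]
  have h' := mul_le_mul_of_nonneg_left hupper hℓ.le
  rw [mul_inv_cancel_left₀ hℓ.ne'] at h'
  have e : ∀ p q : ℝ, ℓ * (p * (ℓ⁻¹ * q)) = p * q := fun p q => by field_simp
  have hlow' := mul_le_mul_of_nonneg_left hlower hℓ.le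
  rw [e] at hlow'
  linarith

/-- A one-sided Wiener–Ikehara inequality. -/
theorem tauberian_inequality (hB : Measurable B) (hB₀ : ∀ u, 0 ≤ B u)
    (hC : ∀ u, 0 < u → B u ≤ C) (hmono : ∀ u v, 0 < u → u ≤ v → B u * Real.exp (u - v) ≤ B v)
    (hg : Continuous (Function.uncurry g))
    (hlap : ∀ σ τ : ℝ, 0 < σ → ∫ u in Set.Ioi (0 : ℝ),
      ((B u - 1 : ℝ) : ℂ) * Complex.exp (-(σ + τ * Complex.I) * u) = g σ τ)
    {a ℓ y : ℝ} (ha : 0 < a) (hℓ : 0 < ℓ) (hy : 0 < y) :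
    B y * Real.exp (-(2 * a)) * ∫ v in (-(ℓ * a))..(ℓ * a), fejerKernel v ≤
    (∫ v, fejerKernel v) + ℓ * ∫ t in (0 : ℝ)..1,
      (1 - t) * (Complex.exp ((ℓ * t : ℝ) * (y + a : ℝ) * Complex.I) * g 0 (ℓ * t)).re := by
  have hR : Continuous fun σ : ℝ => ∫ t in (0 : ℝ)..1,
      (1 - t) * (Complex.exp ((ℓ * t : ℝ) * (y + a : ℝ) * Complex.I) * g σ (ℓ * t)).re := by
    refine intervalIntegral.continuous_parametric_intervalIntegral_of_continuous' ?_ 0 1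
    have : Continuous fun p : ℝ × ℝ => g p.1 (ℓ * p.2) :=
      hg.comp (continuous_fst.prodMk (continuous_const.mul continuous_snd))
    simp only [Function.uncurry_def]
    fun_prop
  have hright : Tendsto (fun σ : ℝ => (∫ v, fejerKernel v) + ℓ * ∫ t in (0 : ℝ)..1,
      (1 - t) * (Complex.exp ((ℓ * t : ℝ) * (y + a : ℝ) * Complex.I) * g σ (ℓ * t)).re)
      (𝓝[>] 0) (𝓝 ((∫ v, fejerKernel v) + ℓ * ∫ t in (0 : ℝ)..1,
      (1 - t) * (Complex.exp ((ℓ * t : ℝ) * (y + a : ℝ) * Complex.I) * g 0 (ℓ * t)).re)) :=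
    ((continuous_const.add (continuous_const.mul hR)).tendsto 0).mono_left nhdsWithin_le_nhds
  have hleft : Tendsto (fun σ : ℝ => B y * Real.exp (-(2 * a)) * Real.exp (-σ * (y + 2 * a)) *
      ∫ v in (-(ℓ * a))..(ℓ * a), fejerKernel v) (𝓝[>] 0)
      (𝓝 (B y * Real.exp (-(2 * a)) * ∫ v in (-(ℓ * a))..(ℓ * a), fejerKernel v)) := by
    have : Continuous fun σ : ℝ => B y * Real.exp (-(2 * a)) * Real.exp (-σ * (y + 2 * a)) *
      ∫ v in (-(ℓ * a))..(ℓ * a), fejerKernel v := by fun_prop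
    simpa using (this.tendsto 0).mono_left nhdsWithin_le_nhds
  refine le_of_tendsto_of_tendsto hleft hright ?_
  filter_upwards [self_mem_nhdsWithin] with σ hσ
  exact tauberian_inequality_of_pos hB hB₀ hC hmono hlap ha hℓ hy hσ

/-- The upper-bound half of the Wiener–Ikehara theorem. -/
theorem eventually_le_of_laplace_continuous (hB : Measurable B) (hB₀ : ∀ u, 0 ≤ B u)
    (hC : ∀ u, 0 < u → B u ≤ C) (hmono : ∀ u v, 0 < u → u ≤ v → B u * Real.exp (u - v) ≤ B v)
    (hg : Continuous (Function.uncurry g))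
    (hlap : ∀ σ τ : ℝ, 0 < σ → ∫ u in Set.Ioi (0 : ℝ),
      ((B u - 1 : ℝ) : ℂ) * Complex.exp (-(σ + τ * Complex.I) * u) = g σ τ)
    {ε : ℝ} (hε : 0 < ε) : ∀ᶠ y in atTop, B y ≤ 1 + ε := by
  set J := ∫ v, fejerKernel v with hJ
  have hJ₀ : 0 < J := integral_fejerKernel_pos
  obtain ⟨a, ha, haε⟩ : ∃ a : ℝ, 0 < a ∧ Real.exp (2 * a) < 1 + ε := by
    have := Real.log_pos (by linarith : 1 < 1 + ε)
    refine ⟨Real.log (1 + ε) / 4, by positivity, ?_⟩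
    calc _ < Real.exp (Real.log (1 + ε)) := Real.exp_lt_exp.mpr (by linarith)
      _ = _ := Real.exp_log (by linarith)
  obtain ⟨ℓ, hℓ, hℓJ⟩ : ∃ ℓ : ℝ, 0 < ℓ ∧
      Real.exp (2 * a) * J < (1 + ε) * ∫ v in (-(ℓ * a))..(ℓ * a), fejerKernel v := by
    have h₁ : Tendsto (fun ℓ : ℝ => ℓ * a) atTop atTop := tendsto_id.atTop_mul_const ha
    have h₂ := (intervalIntegral_tendsto_integral fejerKernel_integrable
      (tendsto_neg_atTop_atBot.comp h₁) h₁).const_mul (1 + ε)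
    have h₃ := h₂.eventually_const_lt (mul_lt_mul_of_pos_right haε hJ₀)
    obtain ⟨ℓ, h, h'⟩ := (h₃.and (eventually_gt_atTop 0)).exists
    exact ⟨ℓ, h', h⟩
  have hcont : Continuous fun t : ℝ => g 0 (ℓ * t) :=
    hg.comp (continuous_const.prodMk (continuous_const.mul continuous_id))
  have hRL := (tendsto_integral_tent_mul_exp hcont hℓ).comp
    (tendsto_atTop_add_const_right _ a tendsto_id)
  have hlim := ((hRL.const_mul ℓ).const_add J).const_mul (Real.exp (2 * a))
  rw [mul_zero, add_zero] at hlim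
  filter_upwards [hlim.eventually_lt_const hℓJ, eventually_gt_atTop 0] with y hy₁ hy
  have hmain := tauberian_inequality hB hB₀ hC hmono hg hlap ha hℓ hy
  have hpos : 0 < ∫ v in (-(ℓ * a))..(ℓ * a), fejerKernel v := by
    by_contra! hle
    nlinarith [mul_pos (Real.exp_pos (2 * a)) hJ₀]
  have hexp : Real.exp (-(2 * a)) * Real.exp (2 * a) = 1 := by rw [← Real.exp_add]; simp
  have hscaled := mul_le_mul_of_nonneg_left hmain (Real.exp_pos (2 * a)).le
  refine le_of_mul_le_mul_right ?_ hpos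
  calc B y * ∫ v in (-(ℓ * a))..(ℓ * a), fejerKernel v
      = Real.exp (2 * a) * (B y * Real.exp (-(2 * a)) *
        ∫ v in (-(ℓ * a))..(ℓ * a), fejerKernel v) := by
        linear_combination (-(B y * ∫ v in (-(ℓ * a))..(ℓ * a), fejerKernel v)) * hexp
    _ ≤ _ := hscaled
    _ ≤ _ := hy₁.le

end Tauberian

/-- The normalised Chebyshev function in logarithmic scale. -/
noncomputable def expPsi (u : ℝ) : ℝ := Chebyshev.psi (Real.exp u) * Real.exp (-u)

theorem expPsi_nonneg (u : ℝ) : 0 ≤ expPsi u :=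
  mul_nonneg (Chebyshev.psi_nonneg _) (Real.exp_pos _).le

theorem measurable_expPsi : Measurable expPsi :=
  (Chebyshev.psi_mono.measurable.comp Real.measurable_exp).mul (by fun_prop)

theorem expPsi_le (u : ℝ) : expPsi u ≤ Real.log 4 + 4 := by
  rw [expPsi, Real.exp_neg, ← div_eq_mul_inv, div_le_iff₀ (Real.exp_pos _)]
  exact Chebyshev.psi_le_const_mul_self (Real.exp_pos _).le

theorem expPsi_mul_exp_le {u v : ℝ} (huv : u ≤ v) : expPsi u * Real.exp (u - v) ≤ expPsi v := by
  rw [expPsi, expPsi, mul_assoc, ← Real.exp_add, show -u + (u - v) = -v by ring]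
  exact mul_le_mul_of_nonneg_right (Chebyshev.psi_mono (Real.exp_le_exp.mpr huv))
    (Real.exp_pos _).le

theorem LSeries_vonMangoldt_eq_mul_laplace {s : ℂ} (hs : 1 < s.re) :
    LSeries (fun n => (ArithmeticFunction.vonMangoldt n : ℂ)) s =
      s * ∫ u in Set.Ioi (0 : ℝ), (expPsi u : ℂ) * Complex.exp (-(s - 1) * u) := by
  have hO : (fun n : ℕ => ∑ k ∈ Finset.Icc 1 n, ArithmeticFunction.vonMangoldt k) =O[atTop]
      fun n => (n : ℝ) ^ (1 : ℝ) := by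
    refine Asymptotics.IsBigO.of_bound (Real.log 4 + 4) (Eventually.of_forall fun n => ?_)
    have h := Chebyshev.psi_le_const_mul_self (Nat.cast_nonneg (α := ℝ) n)
    have h₀ := Chebyshev.psi_nonneg (n : ℝ)
    simp only [Chebyshev.psi, Nat.floor_natCast] at h h₀
    rw [Real.rpow_one, Real.norm_of_nonneg (Nat.cast_nonneg _)]
    change ‖∑ k ∈ Finset.Ioc 0 n, _‖ ≤ _
    rwa [Real.norm_of_nonneg h₀]
  rw [LSeries_eq_mul_integral_of_nonneg _ zero_le_one hs hO
    fun _ => ArithmeticFunction.vonMangoldt_nonneg, ← Real.exp_zero, ← integral_comp_exp_Ioi]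
  congr 1
  refine integral_congr_ae (ae_of_all _ fun u => ?_)
  have hsum : (∑ k ∈ Finset.Icc 1 ⌊Real.exp u⌋₊, (ArithmeticFunction.vonMangoldt k : ℂ)) =
      (Chebyshev.psi (Real.exp u) : ℂ) := by
    rw [Chebyshev.psi]
    push_cast
    rfl
  simp only [hsum, expPsi]
  rw [Complex.cpow_def_of_ne_zero (by exact_mod_cast (Real.exp_pos u).ne'),
    ← Complex.ofReal_log (Real.exp_pos u).le, Real.log_exp, Complex.real_smul]
  push_cast
  rw [mul_left_comm, mul_assoc, ← Complex.exp_add, ← Complex.exp_add]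
  ring_nf

theorem laplace_expPsi_sub_one {s : ℂ} (hs : 1 < s.re) :
    ∫ u in Set.Ioi (0 : ℝ), ((expPsi u - 1 : ℝ) : ℂ) * Complex.exp (-(s - 1) * u) =
      (ArithmeticFunction.vonMangoldt.LFunctionResidueClassAux (1 : ZMod 1) s - 1) / s := by
  have hre : (-(s - 1)).re < 0 := by simp; linarith
  have haux := ArithmeticFunction.vonMangoldt.eqOn_LFunctionResidueClassAux
    (isUnit_one (M := ZMod 1)) hs
  have hres : (fun n : ℕ => (ArithmeticFunction.vonMangoldt.residueClass (1 : ZMod 1) n : ℂ)) =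
      fun n => (ArithmeticFunction.vonMangoldt n : ℂ) := by
    ext n
    rw [ArithmeticFunction.vonMangoldt.residueClass,
      Set.indicator_of_mem (by exact Subsingleton.elim _ _)]
  simp only [hres] at haux
  rw [haux, LSeries_vonMangoldt_eq_mul_laplace hs]
  have hs₀ : s ≠ 0 := fun h => by simp [h] at hs; linarith
  have hs₁ : s - 1 ≠ 0 := fun h => by simp [sub_eq_zero.mp h] at hs
  have hexp := integrableOn_exp_mul_complex_Ioi hre 0
  have hint : IntegrableOn (fun u : ℝ => (expPsi u : ℂ) * Complex.exp (-(s - 1) * u))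
      (Set.Ioi 0) := by
    refine hexp.bdd_mul (c := Real.log 4 + 4)
      (Complex.measurable_ofReal.comp measurable_expPsi).aestronglyMeasurable
      (ae_of_all _ fun u => ?_)
    rw [Complex.norm_real, Real.norm_of_nonneg (expPsi_nonneg u)]
    exact expPsi_le u
  have hsplit : ∫ u in Set.Ioi (0 : ℝ), ((expPsi u - 1 : ℝ) : ℂ) * Complex.exp (-(s - 1) * u) =
      (∫ u in Set.Ioi (0 : ℝ), (expPsi u : ℂ) * Complex.exp (-(s - 1) * u)) -
      ∫ u in Set.Ioi (0 : ℝ), Complex.exp (-(s - 1) * u) := by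
    rw [← integral_sub hint hexp]
    refine integral_congr_ae (ae_of_all _ fun u => ?_)
    push_cast
    ring
  rw [hsplit, integral_exp_mul_complex_Ioi hre, Complex.ofReal_zero, mul_zero, Complex.exp_zero,
    neg_div_neg_eq, Nat.totient_one, Nat.cast_one, inv_one]
  generalize ∫ u in Set.Ioi (0 : ℝ), (expPsi u : ℂ) * Complex.exp (-(s - 1) * u) = A
  field_simp
  ring

theorem eventually_psi_le {ε : ℝ} (hε : 0 < ε) :
    ∀ᶠ x in atTop, Chebyshev.psi x ≤ (1 + ε) * x := by
  let s : ℝ → ℝ → ℂ := fun σ τ => 1 + (max σ 0 : ℝ) + τ * Complex.I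
  have hsre : ∀ σ τ, (s σ τ).re = 1 + max σ 0 := fun σ τ => by simp [s]
  let g : ℝ → ℝ → ℂ := fun σ τ =>
    (ArithmeticFunction.vonMangoldt.LFunctionResidueClassAux (1 : ZMod 1) (s σ τ) - 1) / s σ τ
  have hs : Continuous (Function.uncurry s) := by
    simp only [Function.uncurry_def, s]
    fun_prop
  have hg : Continuous (Function.uncurry g) := by
    refine Continuous.div (Continuous.sub ?_ continuous_const) hs fun p h => ?_
    · refine (ArithmeticFunction.vonMangoldt.continuousOn_LFunctionResidueClassAux
        (1 : ZMod 1)).comp_continuous hs fun p => ?_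
      change 1 ≤ (s p.1 p.2).re
      rw [hsre]
      linarith [le_max_right p.1 0]
    · have h' := hsre p.1 p.2
      rw [show s p.1 p.2 = 0 from h, Complex.zero_re] at h'
      linarith [le_max_right p.1 0]
  have hlap : ∀ σ τ : ℝ, 0 < σ → ∫ u in Set.Ioi (0 : ℝ),
      ((expPsi u - 1 : ℝ) : ℂ) * Complex.exp (-(σ + τ * Complex.I) * u) = g σ τ := by
    intro σ τ hσ
    have hmax : max σ 0 = σ := max_eq_left hσ.le
    have h := laplace_expPsi_sub_one (s := s σ τ) (by rw [hsre, hmax]; linarith)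
    rw [show s σ τ - 1 = σ + τ * Complex.I by simp only [s, hmax]; ring] at h
    exact h
  have hB := eventually_le_of_laplace_continuous measurable_expPsi expPsi_nonneg
    (fun u _ => expPsi_le u) (fun u v _ huv => expPsi_mul_exp_le huv) hg hlap hε
  filter_upwards [Real.tendsto_log_atTop.eventually hB, eventually_gt_atTop 0] with x hx hx₀
  rwa [expPsi, Real.exp_neg, Real.exp_log hx₀, ← div_eq_mul_inv, div_le_iff₀ hx₀] at hx

theorem exists_theta_le {ε : ℝ} (hε : 0 < ε) :
    ∃ C, 0 ≤ C ∧ ∀ x, 0 ≤ x → Chebyshev.theta x ≤ (1 + ε) * x + C := by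
  obtain ⟨x₀, hx₀⟩ := eventually_atTop.mp (eventually_psi_le hε)
  refine ⟨Chebyshev.theta x₀, Chebyshev.theta_nonneg _, fun x hx => ?_⟩
  rcases le_total x₀ x with h | h
  · linarith [Chebyshev.theta_le_psi x, hx₀ x h, Chebyshev.theta_nonneg x₀]
  · have := Chebyshev.theta_mono h
    nlinarith

theorem le_smoothness_of_mem_primeFactors {X Y Z : ℤ} {p : ℕ}
    (hp : p ∈ (X * Y * Z).natAbs.primeFactors)
    (h0 : X * Y * Z ≠ 0) : p ≤ smoothness X Y Z := by
  refine le_csSup ⟨(X * Y * Z).natAbs, fun q hq => ?_⟩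
    ⟨Nat.prime_of_mem_primeFactors hp, Int.natCast_dvd.mpr (Nat.dvd_of_mem_primeFactors hp)⟩
  exact Nat.le_of_dvd (Int.natAbs_pos.mpr h0) (Int.natCast_dvd.mp hq.2)

theorem radical_pos (X Y Z : ℤ) : 0 < radical X Y Z :=
  Finset.prod_pos fun _ hp => Nat.pos_of_mem_primeFactors hp

theorem log_radical_le_theta {X Y Z : ℤ} (h0 : X * Y * Z ≠ 0) :
    Real.log (radical X Y Z) ≤ Chebyshev.theta (smoothness X Y Z) := by
  rw [radical, Nat.cast_prod, Real.log_prod fun p hp =>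
    Nat.cast_ne_zero.mpr (Nat.pos_of_mem_primeFactors hp).ne', Chebyshev.theta, Nat.floor_natCast]
  refine Finset.sum_le_sum_of_subset_of_nonneg (fun p hp => ?_) fun p hp _ => ?_
  · exact Finset.mem_filter.mpr ⟨Finset.mem_Ioc.mpr ⟨Nat.pos_of_mem_primeFactors hp,
      le_smoothness_of_mem_primeFactors hp h0⟩, Nat.prime_of_mem_primeFactors hp⟩
  · exact Real.log_nonneg (by exact_mod_cast (Finset.mem_Ioc.mp (Finset.mem_filter.mp hp).1).1)

theorem three_le_radical {X Y Z : ℤ} (h : IsPrimitiveSolution X Y Z) (hH : 16 ≤ height X Y Z) :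
    3 ≤ radical X Y Z := by
  obtain ⟨hsum, h0, hgcd⟩ := h
  by_contra! hlt
  have htwo : ∀ p : ℕ, p.Prime → (p : ℤ) ∣ X * Y * Z → p = 2 := by
    intro p hp hd
    have hmem : p ∈ (X * Y * Z).natAbs.primeFactors :=
      Nat.mem_primeFactors.mpr ⟨hp, Int.natCast_dvd.mp hd, Int.natAbs_ne_zero.mpr h0⟩
    have := Nat.le_of_dvd (radical_pos X Y Z) (Finset.dvd_prod_of_mem (fun p => p) hmem)
    have := hp.two_le
    omega
  have hunit : ∀ W : ℤ, W ∣ X * Y * Z → ¬ (2 : ℤ) ∣ W → W.natAbs = 1 := by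
    intro W hW hodd
    by_contra hne
    obtain ⟨p, hp, hpW⟩ := Nat.exists_prime_and_dvd hne
    have hpW' : (p : ℤ) ∣ W := Int.natCast_dvd.mpr hpW
    obtain rfl := htwo p hp (hpW'.trans hW)
    exact hodd hpW'
  have hXd : X ∣ X * Y * Z := ⟨Y * Z, by ring⟩
  have hYd : Y ∣ X * Y * Z := ⟨X * Z, by ring⟩
  have hZd : Z ∣ X * Y * Z := ⟨X * Y, by ring⟩
  have hnot : ¬ ((2 : ℤ) ∣ X ∧ (2 : ℤ) ∣ Y) := by
    rintro ⟨h₁, h₂⟩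
    have h₃ : (2 : ℤ) ∣ Z := hsum ▸ dvd_add h₁ h₂
    have := Int.dvd_coe_gcd h₁ (Int.dvd_coe_gcd h₂ h₃)
    rw [hgcd] at this
    norm_num at this
  have hX : (2 : ℤ) ∣ X ∨ X.natAbs = 1 := or_iff_not_imp_left.mpr (hunit X hXd)
  have hY : (2 : ℤ) ∣ Y ∨ Y.natAbs = 1 := or_iff_not_imp_left.mpr (hunit Y hYd)
  have hZ : (2 : ℤ) ∣ Z ∨ Z.natAbs = 1 := or_iff_not_imp_left.mpr (hunit Z hZd)
  simp only [height, Int.abs_eq_natAbs] at hH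
  omega

theorem eventually_mul_exp_mul_pow_lt_exp (A C : ℝ) {κ : ℝ} (hκ : κ < 1) :
    ∀ᶠ L in atTop, A * Real.exp (κ * L) * (3 * κ * L + C) ^ 3 < Real.exp L := by
  have hb : 0 < 1 - κ := sub_pos.mpr hκ
  have hlin : (fun L : ℝ => 3 * κ * L + C) =O[atTop] fun L => L := by
    refine ((Asymptotics.isBigO_refl _ _).const_mul_left _).add ?_
    exact (Asymptotics.isLittleO_const_id_atTop C).isBigO
  have hpow : (fun L : ℝ => L ^ 3) =o[atTop] fun L => Real.exp ((1 - κ) * L) := by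
    simpa using isLittleO_pow_exp_pos_mul_atTop 3 hb
  have h := ((hlin.pow 3).trans_isLittleO hpow).const_mul_left A
  filter_upwards [h.def one_half_pos] with L hL
  rw [Real.norm_of_nonneg (Real.exp_pos _).le] at hL
  have h₁ := (Real.le_norm_self _).trans hL
  have h₂ : Real.exp ((1 - κ) * L) * Real.exp (κ * L) = Real.exp L := by
    rw [← Real.exp_add]; ring_nf
  have h₃ := mul_le_mul_of_nonneg_right h₁ (Real.exp_pos (κ * L)).le
  nlinarith [Real.exp_pos L]

theorem finite_setOf_height_le (M : ℝ) :
    {T : ℤ × ℤ × ℤ | (height T.1 T.2.1 T.2.2 : ℝ) ≤ M}.Finite := by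
  refine ((Set.finite_Icc (-⌊M⌋) ⌊M⌋).prod ((Set.finite_Icc (-⌊M⌋) ⌊M⌋).prod
    (Set.finite_Icc (-⌊M⌋) ⌊M⌋))).subset fun T hT => ?_
  have hT' : height T.1 T.2.1 T.2.2 ≤ ⌊M⌋ := Int.le_floor.mpr hT
  simp only [height, max_le_iff, abs_le] at hT'
  exact ⟨hT'.1, hT'.2.1, hT'.2.2⟩

theorem stewart_yu_implies_xyz_lower_bound (c₁ : ℝ) (hc₁ : 0 < c₁)
    (hSY : ∀ X Y Z : ℤ, IsPrimitiveSolution X Y Z → 3 ≤ radical X Y Z →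
      (height X Y Z : ℝ) ≤ Real.exp (c₁ * (radical X Y Z : ℝ) ^ ((1 : ℝ) / 3) *
        (Real.log (radical X Y Z)) ^ 3)) :
    ∀ ε : ℝ, 0 < ε → ε < 3 →
      {T : ℤ × ℤ × ℤ | IsPrimitiveSolution T.1 T.2.1 T.2.2 ∧
        (16 : ℝ) ≤ (height T.1 T.2.1 T.2.2 : ℝ) ∧
        (smoothness T.1 T.2.1 T.2.2 : ℝ) ≤
          (3 - ε) * Real.log (Real.log (height T.1 T.2.1 T.2.2))}.Finite := by
  intro ε hε hε₃
  obtain ⟨C, -, hC⟩ := exists_theta_le (ε := ε / 3) (by positivity)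
  obtain ⟨L₀, hL₀⟩ := eventually_atTop.mp (eventually_mul_exp_mul_pow_lt_exp
    (c₁ * Real.exp (C / 3)) C (κ := 1 - ε ^ 2 / 9) (by nlinarith [sq_pos_of_pos hε]))
  refine (finite_setOf_height_le (Real.exp (Real.exp L₀))).subset ?_
  rintro ⟨X, Y, Z⟩ ⟨hprim, hH, hS⟩
  simp only at hprim hH hS
  change (height X Y Z : ℝ) ≤ Real.exp (Real.exp L₀)
  have hR₃ := three_le_radical hprim (by exact_mod_cast hH)
  have hR₃' : (3 : ℝ) ≤ (radical X Y Z : ℝ) := by exact_mod_cast hR₃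
  set H : ℝ := (height X Y Z : ℝ)
  have hH₀ : 0 < H := by linarith
  have hlogH : 0 < Real.log H := Real.log_pos (by linarith)
  set L := Real.log (Real.log H) with hL
  set R : ℝ := (radical X Y Z : ℝ)
  have hlogR : Real.log R ≤ 3 * (1 - ε ^ 2 / 9) * L + C := by
    refine (log_radical_le_theta hprim.2.1).trans ((hC _ (Nat.cast_nonneg _)).trans ?_)
    nlinarith
  have hlogR₀ : 0 ≤ Real.log R := Real.log_nonneg (by linarith)
  have hbound : Real.log H ≤ c₁ * R ^ ((1 : ℝ) / 3) * Real.log R ^ 3 :=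
    (Real.log_le_iff_le_exp hH₀).mpr (hSY X Y Z hprim hR₃)
  have hroot : R ^ ((1 : ℝ) / 3) ≤ Real.exp (C / 3) * Real.exp ((1 - ε ^ 2 / 9) * L) := by
    rw [Real.rpow_def_of_pos (by linarith), ← Real.exp_add]
    refine Real.exp_le_exp.mpr ?_
    linarith
  have hfinal : Real.exp L ≤ c₁ * Real.exp (C / 3) * Real.exp ((1 - ε ^ 2 / 9) * L) *
      (3 * (1 - ε ^ 2 / 9) * L + C) ^ 3 := by
    rw [hL, Real.exp_log hlogH, ← hL]
    refine hbound.trans ?_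
    rw [mul_assoc c₁ (Real.exp _)]
    gcongr
  have hlt : L < L₀ := by
    by_contra! hle
    exact absurd hfinal (not_le.mpr (hL₀ L hle))
  rw [← Real.log_le_iff_le_exp hH₀, ← Real.log_le_iff_le_exp hlogH]
  exact hlt.le
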